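/- Let g = 147E1(2) be the 7-dimensional nilpotent real Lie algebra with basis e1,…,e7 and only nonzero brackets [e1,e2] = −e4, [e2,e3] = −e5, [e1,e3] = e6, [e1,e6] = 2e7, [e2,e5] = −2e7, [e2,e6] = −2e7, [e3,e4] = 2e7 (up to antisymmetry). Then: (i) the space of closed alternating 3-forms on g has dimension 20; (ii) the space of derivations of g has dimension 15; (iii) the 3-form φ = −6√6·(2e^{123}−2e^{124}+2e^{135}−e^{157}−e^{167}+2e^{236}+e^{257}+e^{347}+2e^{456}) is closed and the space of derivations stabilizing φ has dimension 1; (iv) there exists δ > 0 such that for every real ε with 0 < |ε| < δ, the only derivation of g stabilizing φ_ε := φ + ε(e^{156}−e^{237}+e^{346}) is 0. -/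

import Mathlib

noncomputable section

/-- The underlying 7-dimensional real vector space. -/
abbrev V : Type := Fin 7 → ℝ

/-- The Lie bracket of the nilpotent Lie algebra `147E1(2)`, extended bilinearly from the structure constants. -/
def bk (x y : V) : V :=
  ![0, 0, 0, -(x 0 * y 1 - x 1 * y 0), -(x 1 * y 2 - x 2 * y 1), x 0 * y 2 - x 2 * y 0,
    2 * (x 0 * y 5 - x 5 * y 0) - 2 * (x 1 * y 4 - x 4 * y 1)
      - 2 * (x 1 * y 5 - x 5 * y 1) + 2 * (x 2 * y 3 - x 3 * y 2)]

/-- The alternating 3-form `e^i ∧ e^j ∧ e^k` on `V`. -/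
def w3 (i j k : Fin 7) : AlternatingMap ℝ V ℝ (Fin 3) :=
  (Matrix.detRowAlternating : AlternatingMap ℝ (Fin 3 → ℝ) ℝ (Fin 3)).compLinearMap
    (LinearMap.pi (fun a => LinearMap.proj (![i, j, k] a)))

/-- Chevalley–Eilenberg differential of a 3-form, as a scalar-valued function. -/
def d3 (φ : AlternatingMap ℝ V ℝ (Fin 3)) (x₀ x₁ x₂ x₃ : V) : ℝ :=
  -(φ ![bk x₀ x₁, x₂, x₃]) + φ ![bk x₀ x₂, x₁, x₃] - φ ![bk x₀ x₃, x₁, x₂]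
    - φ ![bk x₁ x₂, x₀, x₃] + φ ![bk x₁ x₃, x₀, x₂] - φ ![bk x₂ x₃, x₀, x₁]

/-- A 3-form is closed if its Chevalley–Eilenberg differential vanishes. -/
def Closed3 (φ : AlternatingMap ℝ V ℝ (Fin 3)) : Prop :=
  ∀ x₀ x₁ x₂ x₃ : V, d3 φ x₀ x₁ x₂ x₃ = 0

/-- A linear map `D : V → V` is a derivation of the Lie algebra `(V, bk)`. -/
def IsDeriv (D : V →ₗ[ℝ] V) : Prop :=
  ∀ x y : V, D (bk x y) = bk (D x) y + bk x (D y)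

/-- `D` stabilizes (annihilates infinitesimally) the 3-form `φ`. -/
def Stab3 (φ : AlternatingMap ℝ V ℝ (Fin 3)) (D : V →ₗ[ℝ] V) : Prop :=
  ∀ x y z : V, φ ![D x, y, z] + φ ![x, D y, z] + φ ![x, y, D z] = 0

/-- The distinguished 3-form. -/
def phi : AlternatingMap ℝ V ℝ (Fin 3) :=
  ((-6 : ℝ) * Real.sqrt 6) •
    ((2 : ℝ) • w3 0 1 2 - (2 : ℝ) • w3 0 1 3 + (2 : ℝ) • w3 0 2 4 - w3 0 4 6 - w3 0 5 6
      + (2 : ℝ) • w3 1 2 5 + w3 1 4 6 + w3 2 3 6 + (2 : ℝ) • w3 3 4 5)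

/-- The perturbation 3-form. -/
def eta : AlternatingMap ℝ V ℝ (Fin 3) :=
  w3 0 4 5 - w3 1 2 6 + w3 2 3 5

/-- The standard basis vectors of `V`. -/
def e (i : Fin 7) : V := Pi.single i 1

lemma e_apply (i j : Fin 7) : e i j = if j = i then 1 else 0 := by
  simp [e, Pi.single_apply]

lemma bk_e :
    bk (e 0) (e 1) = -e 3 ∧
    bk (e 0) (e 2) = e 5 ∧
    bk (e 0) (e 3) = 0 ∧
    bk (e 0) (e 4) = 0 ∧
    bk (e 0) (e 5) = (2 : ℝ) • e 6 ∧
    bk (e 0) (e 6) = 0 ∧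
    bk (e 1) (e 2) = -e 4 ∧
    bk (e 1) (e 3) = 0 ∧
    bk (e 1) (e 4) = -((2 : ℝ) • e 6) ∧
    bk (e 1) (e 5) = -((2 : ℝ) • e 6) ∧
    bk (e 1) (e 6) = 0 ∧
    bk (e 2) (e 3) = (2 : ℝ) • e 6 ∧
    bk (e 2) (e 4) = 0 ∧
    bk (e 2) (e 5) = 0 ∧
    bk (e 2) (e 6) = 0 ∧
    bk (e 3) (e 4) = 0 ∧
    bk (e 3) (e 5) = 0 ∧
    bk (e 3) (e 6) = 0 ∧
    bk (e 4) (e 5) = 0 ∧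
    bk (e 4) (e 6) = 0 ∧
    bk (e 5) (e 6) = 0 := by
  refine ⟨?_, ?_, ?_, ?_, ?_, ?_, ?_, ?_, ?_, ?_, ?_, ?_, ?_, ?_, ?_, ?_, ?_, ?_, ?_, ?_, ?_⟩ <;>
    (ext i; fin_cases i <;> simp [bk, e_apply])

section Forms

variable (φ : AlternatingMap ℝ V ℝ (Fin 3))

lemma form_smul (c : ℝ) (x y z : V) : φ ![c • x, y, z] = c * φ ![x, y, z] :=
  φ.toMultilinearMap.cons_smul ![y, z] c x

lemma form_neg (x y z : V) : φ ![-x, y, z] = -φ ![x, y, z] := by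
  simpa using form_smul φ (-1) x y z

lemma form_zero (y z : V) : φ ![0, y, z] = 0 := by
  simpa using form_smul φ 0 0 y z

lemma form_swap_left (x y z : V) : φ ![x, y, z] = -φ ![y, x, z] := by
  rw [← φ.map_swap ![y, x, z] (show (0 : Fin 3) ≠ 1 by decide)]
  congr 1
  ext i : 1
  fin_cases i <;> rfl

lemma form_swap_right (x y z : V) : φ ![x, y, z] = -φ ![x, z, y] := by
  rw [← φ.map_swap ![x, z, y] (show (1 : Fin 3) ≠ 2 by decide)]
  congr 1
  ext i : 1
  fin_cases i <;> rfl

lemma form_self_left (x z : V) : φ ![x, x, z] = 0 :=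
  φ.map_eq_zero_of_eq _ (show ![x, x, z] 0 = ![x, x, z] 1 from rfl) (by decide)

lemma form_self_right (x y : V) : φ ![x, y, y] = 0 :=
  φ.map_eq_zero_of_eq _ (show ![x, y, y] 1 = ![x, y, y] 2 from rfl) (by decide)

lemma form_sort_left {i j : Fin 7} (k : Fin 7) (_ : j < i) :
    φ ![e i, e j, e k] = -φ ![e j, e i, e k] :=
  form_swap_left φ _ _ _

lemma form_sort_right (i : Fin 7) {j k : Fin 7} (_ : k < j) :
    φ ![e i, e j, e k] = -φ ![e i, e k, e j] :=
  form_swap_right φ _ _ _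

end Forms

/-- Alternating 3-forms agreeing on increasing triples of basis vectors are equal. -/
lemma form_ext {φ ψ : AlternatingMap ℝ V ℝ (Fin 3)}
    (h : ∀ i j k : Fin 7, i < j → j < k → φ ![e i, e j, e k] = ψ ![e i, e j, e k]) : φ = ψ := by
  refine Module.Basis.ext_alternating (Pi.basisFun ℝ (Fin 7)) fun v hv => ?_
  have hs : StrictMono (v ∘ Tuple.sort v) :=
    (Tuple.monotone_sort v).strictMono_of_injective (hv.comp (Tuple.sort v).injective)
  have key := h _ _ _ (hs (show (0 : Fin 3) < 1 by decide)) (hs (show (1 : Fin 3) < 2 by decide))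
  have hw : (![e ((v ∘ Tuple.sort v) 0), e ((v ∘ Tuple.sort v) 1), e ((v ∘ Tuple.sort v) 2)]) =
      (fun i => Pi.basisFun ℝ (Fin 7) (v i)) ∘ Tuple.sort v := by
    ext i : 1
    fin_cases i <;> simp [e]
  rw [hw, φ.map_perm, ψ.map_perm] at key
  exact (smul_right_injective ℝ (Equiv.Perm.sign (Tuple.sort v)).ne_zero) key

lemma w3_apply (i j k : Fin 7) (x y z : V) :
    w3 i j k ![x, y, z] = x i * y j * z k - x i * y k * z j - x j * y i * z k
      + x j * y k * z i + x k * y i * z j - x k * y j * z i := by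
  refine (Matrix.det_fin_three _).trans ?_
  simp

lemma w3_e {i j k a b c : Fin 7} (hij : i < j) (hjk : j < k) (hab : a < b) (hbc : b < c) :
    w3 i j k ![e a, e b, e c] = if i = a ∧ j = b ∧ k = c then 1 else 0 := by
  simp only [w3_apply, e_apply]
  grind

/-- The closed 3-forms. -/
def closedForms : Submodule ℝ (AlternatingMap ℝ V ℝ (Fin 3)) where
  carrier := {φ | Closed3 φ}
  zero_mem' := by simp [Closed3, d3]
  add_mem' {φ ψ} hφ hψ x₀ x₁ x₂ x₃ := by
    have h := hφ x₀ x₁ x₂ x₃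
    have h' := hψ x₀ x₁ x₂ x₃
    simp only [d3, AlternatingMap.add_apply] at h h' ⊢
    linear_combination h + h'
  smul_mem' c φ hφ x₀ x₁ x₂ x₃ := by
    have h := hφ x₀ x₁ x₂ x₃
    simp only [d3, AlternatingMap.smul_apply, smul_eq_mul] at h ⊢
    linear_combination c * h

/-- A basis of the closed 3-forms. -/
def closedBasis : Fin 20 → AlternatingMap ℝ V ℝ (Fin 3) :=
  ![
    w3 0 1 2,
    w3 0 1 3,
    w3 0 1 4,
    w3 0 1 5,
    w3 0 1 6 + (2 : ℝ) • w3 1 3 5,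
    w3 0 2 3,
    w3 0 2 4,
    w3 0 2 5,
    w3 0 2 6 - (2 : ℝ) • w3 2 3 5 - (2 : ℝ) • w3 2 3 4,
    w3 0 3 4 - w3 1 3 5,
    w3 0 3 5,
    w3 0 4 5 - w3 2 3 5,
    w3 0 4 6 - (2 : ℝ) • w3 3 4 5 - w3 2 3 6 - w3 1 4 6 + w3 0 5 6,
    w3 1 2 3,
    w3 1 2 4,
    w3 1 2 5,
    w3 1 2 6 - (2 : ℝ) • w3 2 3 5,
    w3 1 3 4,
    w3 1 4 5 + w3 2 3 4,
    w3 2 4 5]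

lemma sum_closedBasis (g : Fin 20 → ℝ) : ∑ i, g i • closedBasis i =
    g 0 • (w3 0 1 2) +
    g 1 • (w3 0 1 3) +
    g 2 • (w3 0 1 4) +
    g 3 • (w3 0 1 5) +
    g 4 • (w3 0 1 6 + (2 : ℝ) • w3 1 3 5) +
    g 5 • (w3 0 2 3) +
    g 6 • (w3 0 2 4) +
    g 7 • (w3 0 2 5) +
    g 8 • (w3 0 2 6 - (2 : ℝ) • w3 2 3 5 - (2 : ℝ) • w3 2 3 4) +
    g 9 • (w3 0 3 4 - w3 1 3 5) +
    g 10 • (w3 0 3 5) +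
    g 11 • (w3 0 4 5 - w3 2 3 5) +
    g 12 • (w3 0 4 6 - (2 : ℝ) • w3 3 4 5 - w3 2 3 6 - w3 1 4 6 + w3 0 5 6) +
    g 13 • (w3 1 2 3) +
    g 14 • (w3 1 2 4) +
    g 15 • (w3 1 2 5) +
    g 16 • (w3 1 2 6 - (2 : ℝ) • w3 2 3 5) +
    g 17 • (w3 1 3 4) +
    g 18 • (w3 1 4 5 + w3 2 3 4) +
    g 19 • (w3 2 4 5) := by
  simp only [Fin.sum_univ_succ, closedBasis]
  simp [add_assoc]

lemma closed3_closedBasis (i : Fin 20) : Closed3 (closedBasis i) := by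
  intro x₀ x₁ x₂ x₃
  fin_cases i <;> simp [closedBasis, d3, bk, w3_apply] <;> ring

lemma linearIndependent_closedBasis : LinearIndependent ℝ closedBasis := by
  rw [Fintype.linearIndependent_iff]
  intro g hg
  rw [sum_closedBasis] at hg
  have h (a b c : Fin 7) := DFunLike.congr_fun hg ![e a, e b, e c]
  intro i
  fin_cases i
  · simpa [w3_e] using h 0 1 2
  · simpa [w3_e] using h 0 1 3
  · simpa [w3_e] using h 0 1 4
  · simpa [w3_e] using h 0 1 5
  · simpa [w3_e] using h 0 1 6
  · simpa [w3_e] using h 0 2 3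
  · simpa [w3_e] using h 0 2 4
  · simpa [w3_e] using h 0 2 5
  · simpa [w3_e] using h 0 2 6
  · simpa [w3_e] using h 0 3 4
  · simpa [w3_e] using h 0 3 5
  · simpa [w3_e] using h 0 4 5
  · simpa [w3_e] using h 0 4 6
  · simpa [w3_e] using h 1 2 3
  · simpa [w3_e] using h 1 2 4
  · simpa [w3_e] using h 1 2 5
  · simpa [w3_e] using h 1 2 6
  · simpa [w3_e] using h 1 3 4
  · simpa [w3_e] using h 1 4 5
  · simpa [w3_e] using h 2 4 5

lemma closed_relations {φ : AlternatingMap ℝ V ℝ (Fin 3)} (h : Closed3 φ) :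
    φ ![e 4, e 5, e 6] = 0 ∧
    φ ![e 3, e 5, e 6] = 0 ∧
    φ ![e 3, e 4, e 6] = 0 ∧
    φ ![e 3, e 4, e 5] = -2 * φ ![e 0, e 4, e 6] ∧
    φ ![e 2, e 5, e 6] = 0 ∧
    φ ![e 2, e 4, e 6] = 0 ∧
    φ ![e 2, e 3, e 6] = -φ ![e 0, e 4, e 6] ∧
    φ ![e 2, e 3, e 5] = -2 * φ ![e 0, e 2, e 6] - φ ![e 0, e 4, e 5] - 2 * φ ![e 1, e 2, e 6] ∧
    φ ![e 2, e 3, e 4] = -2 * φ ![e 0, e 2, e 6] + φ ![e 1, e 4, e 5] ∧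
    φ ![e 1, e 5, e 6] = 0 ∧
    φ ![e 1, e 4, e 6] = -φ ![e 0, e 4, e 6] ∧
    φ ![e 1, e 3, e 6] = 0 ∧
    φ ![e 1, e 3, e 5] = 2 * φ ![e 0, e 1, e 6] - φ ![e 0, e 3, e 4] ∧
    φ ![e 0, e 5, e 6] = φ ![e 0, e 4, e 6] ∧
    φ ![e 0, e 3, e 6] = 0 := by
  obtain ⟨b01, b02, b03, b04, b05, b06, b12, b13, b14, b15, b16, b23, b24, b25, b26, b34, b35, b36,
    b45, b46, b56⟩ := bk_e
  have h0123 := h (e 0) (e 1) (e 2) (e 3)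
  have h0124 := h (e 0) (e 1) (e 2) (e 4)
  have h0125 := h (e 0) (e 1) (e 2) (e 5)
  have h0126 := h (e 0) (e 1) (e 2) (e 6)
  have h0134 := h (e 0) (e 1) (e 3) (e 4)
  have h0135 := h (e 0) (e 1) (e 3) (e 5)
  have h0145 := h (e 0) (e 1) (e 4) (e 5)
  have h0146 := h (e 0) (e 1) (e 4) (e 6)
  have h0156 := h (e 0) (e 1) (e 5) (e 6)
  have h0234 := h (e 0) (e 2) (e 3) (e 4)
  have h0235 := h (e 0) (e 2) (e 3) (e 5)
  have h0236 := h (e 0) (e 2) (e 3) (e 6)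
  have h0245 := h (e 0) (e 2) (e 4) (e 5)
  have h0246 := h (e 0) (e 2) (e 4) (e 6)
  have h0345 := h (e 0) (e 3) (e 4) (e 5)
  have h1234 := h (e 1) (e 2) (e 3) (e 4)
  have h1235 := h (e 1) (e 2) (e 3) (e 5)
  have h1236 := h (e 1) (e 2) (e 3) (e 6)
  have h1245 := h (e 1) (e 2) (e 4) (e 5)
  have h1256 := h (e 1) (e 2) (e 5) (e 6)
  have h1345 := h (e 1) (e 3) (e 4) (e 5)
  have h2345 := h (e 2) (e 3) (e 4) (e 5)
  simp only [d3, b01, b02, b03, b04, b05, b06, b12, b13, b14, b15, b16, b23, b24, b25, b26, b34,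
    b35, b36, b45, b46, b56, form_neg, form_smul,
    form_zero]
    at h0123 h0124 h0125 h0126 h0134 h0135 h0145 h0146 h0156 h0234 h0235 h0236 h0245 h0246 h0345
      h1234 h1235 h1236 h1245 h1256 h1345 h2345
  simp (disch := decide) only [form_sort_left, form_sort_right, form_self_left,
    form_self_right]
    at h0123 h0124 h0125 h0126 h0134 h0135 h0145 h0146 h0156 h0234 h0235 h0236 h0245 h0246 h0345
      h1234 h1235 h1236 h1245 h1256 h1345 h2345
  refine ⟨?_, ?_, ?_, ?_, ?_, ?_, ?_, ?_, ?_, ?_, ?_, ?_, ?_, ?_, ?_⟩ <;> linarith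

set_option maxHeartbeats 1000000 in
lemma closedForms_le_span : closedForms ≤ Submodule.span ℝ (Set.range closedBasis) := by
  intro φ (h : Closed3 φ)
  rw [Submodule.mem_span_range_iff_exists_fun]
  refine ⟨![
    φ ![e 0, e 1, e 2],
    φ ![e 0, e 1, e 3],
    φ ![e 0, e 1, e 4],
    φ ![e 0, e 1, e 5],
    φ ![e 0, e 1, e 6],
    φ ![e 0, e 2, e 3],
    φ ![e 0, e 2, e 4],
    φ ![e 0, e 2, e 5],
    φ ![e 0, e 2, e 6],
    φ ![e 0, e 3, e 4],
    φ ![e 0, e 3, e 5],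
    φ ![e 0, e 4, e 5],
    φ ![e 0, e 4, e 6],
    φ ![e 1, e 2, e 3],
    φ ![e 1, e 2, e 4],
    φ ![e 1, e 2, e 5],
    φ ![e 1, e 2, e 6],
    φ ![e 1, e 3, e 4],
    φ ![e 1, e 4, e 5],
    φ ![e 2, e 4, e 5]], ?_⟩
  rw [sum_closedBasis]
  obtain ⟨r456, r356, r346, r345, r256, r246, r236, r235, r234, r156, r146, r136, r135, r056, r036⟩
    := closed_relations h
  apply form_ext
  intro i j k hij hjk
  fin_cases i <;> fin_cases j <;> first | exact absurd hij (by decide) | skip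
  all_goals fin_cases k <;> first | exact absurd hjk (by decide) | skip
  all_goals simp [w3_e]
  all_goals linarith

/-- The derivation with given free matrix entries. -/
def der (p : Fin 15 → ℝ) : V →ₗ[ℝ] V :=
  Matrix.toLin' !![p 0, -p 1, 0, 0, 0, 0, 0;
    p 1, p 0 - p 1, 0, 0, 0, 0, 0;
    0, 0, p 2, 0, 0, 0, 0;
    p 3, p 4, p 5, 2 * p 0 - p 1, 0, 0, 0;
    p 6, p 7, p 8, 0, p 0 - p 1 + p 2, -p 1, 0;
    p 9, p 10, p 11, 0, p 1, p 0 + p 2, 0;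
    p 12, p 13, p 14, -2 * p 6 - 2 * p 9 - 2 * p 10, 2 * p 4 + 2 * p 8 + 2 * p 11, -2 * p 3 + 2 * p
      11, 2 * p 0 - p 1 + p 2]

lemma der_apply (p : Fin 15 → ℝ) (x : V) : der p x =
    ![p 0 * x 0 - p 1 * x 1,
      p 1 * x 0 + (p 0 - p 1) * x 1,
      p 2 * x 2,
      p 3 * x 0 + p 4 * x 1 + p 5 * x 2 + (2 * p 0 - p 1) * x 3,
      p 6 * x 0 + p 7 * x 1 + p 8 * x 2 + (p 0 - p 1 + p 2) * x 4 - p 1 * x 5,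
      p 9 * x 0 + p 10 * x 1 + p 11 * x 2 + p 1 * x 4 + (p 0 + p 2) * x 5,
      p 12 * x 0 + p 13 * x 1 + p 14 * x 2 + (-2 * p 6 - 2 * p 9 - 2 * p 10) * x 3 + (2 * p 4 + 2 *
        p 8 + 2 * p 11) * x 4 + (-2 * p 3 + 2 * p 11) * x 5 + (2 * p 0 - p 1 + p 2) * x 6] := by
  ext i
  fin_cases i <;> simp [der, Matrix.mulVec, dotProduct, Fin.sum_univ_succ] <;> ring

lemma isDeriv_der (p : Fin 15 → ℝ) : IsDeriv (der p) := by
  intro x y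
  simp only [der_apply]
  ext i
  fin_cases i <;> simp [bk] <;> ring

/-- `der` as a linear map. -/
def derMap : (Fin 15 → ℝ) →ₗ[ℝ] V →ₗ[ℝ] V where
  toFun := der
  map_add' p q := by
    refine LinearMap.ext fun x => ?_
    rw [LinearMap.add_apply]
    simp only [der_apply]
    ext i
    fin_cases i <;> simp <;> ring
  map_smul' c p := by
    refine LinearMap.ext fun x => ?_
    rw [RingHom.id_apply, LinearMap.smul_apply]
    simp only [der_apply]
    ext i
    fin_cases i <;> simp <;> ring

lemma derMap_injective : Function.Injective derMap := by
  rw [← LinearMap.ker_eq_bot, LinearMap.ker_eq_bot']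
  intro p (hp : der p = 0)
  have h (j i : Fin 7) := congrFun (DFunLike.congr_fun hp (e j)) i
  ext k
  fin_cases k
  · simpa [der_apply, e_apply] using h 0 0
  · simpa [der_apply, e_apply] using h 0 1
  · simpa [der_apply, e_apply] using h 2 2
  · simpa [der_apply, e_apply] using h 0 3
  · simpa [der_apply, e_apply] using h 1 3
  · simpa [der_apply, e_apply] using h 2 3
  · simpa [der_apply, e_apply] using h 0 4
  · simpa [der_apply, e_apply] using h 1 4
  · simpa [der_apply, e_apply] using h 2 4
  · simpa [der_apply, e_apply] using h 0 5
  · simpa [der_apply, e_apply] using h 1 5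
  · simpa [der_apply, e_apply] using h 2 5
  · simpa [der_apply, e_apply] using h 0 6
  · simpa [der_apply, e_apply] using h 1 6
  · simpa [der_apply, e_apply] using h 2 6

lemma deriv_relations {D : V →ₗ[ℝ] V} (h : IsDeriv D) :
    D (e 6) 0 = 0 ∧
    D (e 6) 1 = 0 ∧
    D (e 6) 2 = 0 ∧
    D (e 6) 3 = 0 ∧
    D (e 6) 4 = 0 ∧
    D (e 6) 5 = 0 ∧
    D (e 6) 6 = 2 * D (e 0) 0 - D (e 0) 1 + D (e 2) 2 ∧
    D (e 5) 0 = 0 ∧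
    D (e 5) 1 = 0 ∧
    D (e 5) 2 = 0 ∧
    D (e 5) 3 = 0 ∧
    D (e 5) 4 = -D (e 0) 1 ∧
    D (e 5) 5 = D (e 0) 0 + D (e 2) 2 ∧
    D (e 5) 6 = -2 * D (e 0) 3 + 2 * D (e 2) 5 ∧
    D (e 4) 0 = 0 ∧
    D (e 4) 1 = 0 ∧
    D (e 4) 2 = 0 ∧
    D (e 4) 3 = 0 ∧
    D (e 4) 4 = D (e 0) 0 - D (e 0) 1 + D (e 2) 2 ∧
    D (e 4) 5 = D (e 0) 1 ∧
    D (e 4) 6 = 2 * D (e 1) 3 + 2 * D (e 2) 4 + 2 * D (e 2) 5 ∧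
    D (e 3) 0 = 0 ∧
    D (e 3) 1 = 0 ∧
    D (e 3) 2 = 0 ∧
    D (e 3) 3 = 2 * D (e 0) 0 - D (e 0) 1 ∧
    D (e 3) 4 = 0 ∧
    D (e 3) 5 = 0 ∧
    D (e 3) 6 = -2 * D (e 0) 4 - 2 * D (e 0) 5 - 2 * D (e 1) 5 ∧
    D (e 2) 0 = 0 ∧
    D (e 2) 1 = 0 ∧
    D (e 1) 0 = -D (e 0) 1 ∧
    D (e 1) 1 = D (e 0) 0 - D (e 0) 1 ∧
    D (e 1) 2 = 0 ∧
    D (e 0) 2 = 0 := by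
  obtain ⟨b01, b02, b03, b04, b05, b06, b12, b13, b14, b15, b16, b23, b24, b25, b26, b34, b35, b36,
    b45, b46, b56⟩ := bk_e
  have h01 := h (e 0) (e 1)
  have h02 := h (e 0) (e 2)
  have h03 := h (e 0) (e 3)
  have h04 := h (e 0) (e 4)
  have h05 := h (e 0) (e 5)
  have h12 := h (e 1) (e 2)
  have h13 := h (e 1) (e 3)
  have h14 := h (e 1) (e 4)
  have h24 := h (e 2) (e 4)
  have h25 := h (e 2) (e 5)
  simp only [b01, b02, b03, b04, b05, b12, b13, b14, b24, b25, map_neg, map_smul, map_zero]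
    at h01 h02 h03 h04 h05 h12 h13 h14 h24 h25
  have h01_0 := congrFun h01 0
  have h01_1 := congrFun h01 1
  have h01_2 := congrFun h01 2
  have h01_3 := congrFun h01 3
  have h01_4 := congrFun h01 4
  have h01_5 := congrFun h01 5
  have h01_6 := congrFun h01 6
  have h02_0 := congrFun h02 0
  have h02_1 := congrFun h02 1
  have h02_2 := congrFun h02 2
  have h02_3 := congrFun h02 3
  have h02_4 := congrFun h02 4
  have h02_5 := congrFun h02 5
  have h02_6 := congrFun h02 6
  have h03_6 := congrFun h03 6
  have h04_3 := congrFun h04 3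
  have h04_5 := congrFun h04 5
  have h04_6 := congrFun h04 6
  have h05_0 := congrFun h05 0
  have h05_1 := congrFun h05 1
  have h05_2 := congrFun h05 2
  have h05_3 := congrFun h05 3
  have h05_4 := congrFun h05 4
  have h05_5 := congrFun h05 5
  have h05_6 := congrFun h05 6
  have h12_0 := congrFun h12 0
  have h12_3 := congrFun h12 3
  have h12_4 := congrFun h12 4
  have h12_5 := congrFun h12 5
  have h12_6 := congrFun h12 6
  have h13_6 := congrFun h13 6
  have h14_6 := congrFun h14 6
  have h24_6 := congrFun h24 6
  have h25_6 := congrFun h25 6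
  simp [bk, e_apply]
    at h01_0 h01_1 h01_2 h01_3 h01_4 h01_5 h01_6 h02_0 h02_1 h02_2 h02_3 h02_4 h02_5 h02_6 h03_6
      h04_3 h04_5 h04_6 h05_0 h05_1 h05_2 h05_3 h05_4 h05_5 h05_6 h12_0 h12_3 h12_4 h12_5 h12_6
      h13_6 h14_6 h24_6 h25_6
  refine ⟨?_, ?_, ?_, ?_, ?_, ?_, ?_, ?_, ?_, ?_, ?_, ?_, ?_, ?_, ?_, ?_, ?_, ?_, ?_, ?_, ?_, ?_,
    ?_, ?_, ?_, ?_, ?_, ?_, ?_, ?_, ?_, ?_, ?_, ?_⟩ <;>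
    linarith

lemma IsDeriv.exists_der {D : V →ₗ[ℝ] V} (h : IsDeriv D) : ∃ p, D = der p := by
  refine ⟨![D (e 0) 0, D (e 0) 1, D (e 2) 2, D (e 0) 3, D (e 1) 3, D (e 2) 3, D (e 0) 4, D (e 1) 4,
    D (e 2) 4, D (e 0) 5, D (e 1) 5, D (e 2) 5, D (e 0) 6, D (e 1) 6, D (e 2) 6], ?_⟩
  obtain ⟨r06, r16, r26, r36, r46, r56, r66, r05, r15, r25, r35, r45, r55, r65, r04, r14, r24, r34,
    r44, r54, r64, r03, r13, r23, r33, r43, r53, r63, r02, r12, r01, r11, r21, r20⟩ :=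
    deriv_relations h
  refine (Pi.basisFun ℝ (Fin 7)).ext fun j => ?_
  change D (Pi.basisFun ℝ (Fin 7) j) = _
  rw [show Pi.basisFun ℝ (Fin 7) j = e j by simp [e]]
  ext i
  fin_cases j <;> fin_cases i <;> simp [der_apply, e_apply] <;> linarith

/-- The form `phi` up to normalization. -/
def phi₀ : AlternatingMap ℝ V ℝ (Fin 3) :=
  (2 : ℝ) • w3 0 1 2 - (2 : ℝ) • w3 0 1 3 + (2 : ℝ) • w3 0 2 4 - w3 0 4 6 - w3 0 5 6
    + (2 : ℝ) • w3 1 2 5 + w3 1 4 6 + w3 2 3 6 + (2 : ℝ) • w3 3 4 5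

lemma coeff_ne_zero : (-6 : ℝ) * Real.sqrt 6 ≠ 0 :=
  mul_ne_zero (by norm_num) (Real.sqrt_ne_zero'.2 (by norm_num))

lemma phi_add_smul_eta (ε : ℝ) :
    phi + ε • eta = ((-6 : ℝ) * Real.sqrt 6) • (phi₀ + (ε / ((-6) * Real.sqrt 6)) • eta) := by
  rw [smul_add, smul_smul, mul_div_cancel₀ _ coeff_ne_zero]
  rfl

lemma closed3_phi : Closed3 phi := by
  refine closedForms.smul_mem (x := phi₀) _ fun x₀ x₁ x₂ x₃ => ?_
  simp [phi₀, d3, bk, w3_apply]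
  ring

lemma stab3_smul_iff {c : ℝ} (hc : c ≠ 0) (φ : AlternatingMap ℝ V ℝ (Fin 3)) (D : V →ₗ[ℝ] V) :
    Stab3 (c • φ) D ↔ Stab3 φ D := by
  simp [Stab3, ← mul_add, hc]

set_option maxHeartbeats 1000000 in
lemma stab3_relations {q : ℝ} {p : Fin 15 → ℝ} (h : Stab3 (phi₀ + q • eta) (der p)) :
    4 * p 0 - 2 * p 1 + 2 * p 2 - 2 * p 5 - 2 * p 7 + 2 * p 9 + q * (-p 12) = 0 ∧
    -8 * p 0 + 4 * p 1 = 0 ∧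
    p 12 + p 13 + q * (-p 10) = 0 ∧
    p 13 + q * (p 7) = 0 ∧
    -p 6 - p 7 - p 10 = 0 ∧
    p 12 + q * (p 9) = 0 ∧
    4 * p 0 - 2 * p 1 + 4 * p 2 + p 14 + q * (-p 11) = 0 ∧
    p 14 + q * (-p 3 + p 8) = 0 ∧
    -p 3 - p 8 - p 11 + q * (-p 1) = 0 ∧
    -2 * p 6 - 2 * p 10 = 0 ∧
    -4 * p 6 - 2 * p 9 - 2 * p 10 = 0 ∧
    4 * p 3 + 2 * p 4 + 2 * p 8 + q * (3 * p 0 - p 1 + 2 * p 2) = 0 ∧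
    -4 * p 0 + 2 * p 1 - 2 * p 2 = 0 ∧
    -4 * p 0 + 2 * p 1 - 2 * p 2 = 0 ∧
    p 13 + q * (2 * p 6 + 2 * p 9 + 3 * p 10) = 0 ∧
    -p 14 + q * (-2 * p 4 - 2 * p 8 - 2 * p 11) = 0 ∧
    4 * p 0 - 2 * p 1 + 4 * p 2 + q * (2 * p 3 - p 4 - 2 * p 11) = 0 ∧
    -p 4 + p 8 + q * (-3 * p 0 + 2 * p 1 - 2 * p 2) = 0 ∧
    2 * p 6 + 2 * p 9 + 4 * p 10 = 0 ∧
    -2 * p 7 = 0 ∧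
    -2 * p 3 + 2 * p 4 + 2 * p 11 + q * (-p 1) = 0 ∧
    4 * p 0 - 2 * p 1 + 2 * p 2 = 0 ∧
    2 * p 4 + 2 * p 8 + 4 * p 11 + q * (p 1) = 0 ∧
    -2 * p 3 - 2 * p 8 + 2 * p 11 + q * (3 * p 0 - p 1 + 2 * p 2) = 0 ∧
    4 * p 0 - 2 * p 1 + 2 * p 2 = 0 ∧
    2 * p 5 = 0 ∧
    8 * p 0 - 4 * p 1 + 4 * p 2 = 0 := by
  have h012 := h (e 0) (e 1) (e 2)
  have h013 := h (e 0) (e 1) (e 3)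
  have h014 := h (e 0) (e 1) (e 4)
  have h015 := h (e 0) (e 1) (e 5)
  have h016 := h (e 0) (e 1) (e 6)
  have h023 := h (e 0) (e 2) (e 3)
  have h024 := h (e 0) (e 2) (e 4)
  have h025 := h (e 0) (e 2) (e 5)
  have h026 := h (e 0) (e 2) (e 6)
  have h034 := h (e 0) (e 3) (e 4)
  have h035 := h (e 0) (e 3) (e 5)
  have h045 := h (e 0) (e 4) (e 5)
  have h046 := h (e 0) (e 4) (e 6)
  have h056 := h (e 0) (e 5) (e 6)
  have h123 := h (e 1) (e 2) (e 3)
  have h124 := h (e 1) (e 2) (e 4)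
  have h125 := h (e 1) (e 2) (e 5)
  have h126 := h (e 1) (e 2) (e 6)
  have h134 := h (e 1) (e 3) (e 4)
  have h135 := h (e 1) (e 3) (e 5)
  have h145 := h (e 1) (e 4) (e 5)
  have h146 := h (e 1) (e 4) (e 6)
  have h234 := h (e 2) (e 3) (e 4)
  have h235 := h (e 2) (e 3) (e 5)
  have h236 := h (e 2) (e 3) (e 6)
  have h245 := h (e 2) (e 4) (e 5)
  have h345 := h (e 3) (e 4) (e 5)
  simp [phi₀, eta, w3_apply, der_apply, e_apply]
    at h012 h013 h014 h015 h016 h023 h024 h025 h026 h034 h035 h045 h046 h056 h123 h124 h125 h126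
      h134 h135 h145 h146 h234 h235 h236 h245 h345
  refine ⟨?_, ?_, ?_, ?_, ?_, ?_, ?_, ?_, ?_, ?_, ?_, ?_, ?_, ?_, ?_, ?_, ?_, ?_, ?_, ?_, ?_, ?_,
    ?_, ?_, ?_, ?_, ?_⟩ <;> linarith

/-- A derivation spanning the stabilizer of `phi`. -/
def stabDer : V →ₗ[ℝ] V := der ![1, 2, 0, 0, 0, 0, 0, 0, 0, 0, 0, 0, 0, 0, 0]

lemma stabDer_ne_zero : stabDer ≠ 0 := fun h => by
  simpa [stabDer, der_apply, e_apply] using congrFun (DFunLike.congr_fun h (e 0)) 0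

lemma stab3_phi₀_stabDer : Stab3 phi₀ stabDer := by
  intro x y z
  simp [phi₀, w3_apply, stabDer, der_apply]
  ring

lemma isDeriv_and_stab3_phi_iff (D : V →ₗ[ℝ] V) :
    D ∈ Submodule.span ℝ {stabDer} ↔ IsDeriv D ∧ Stab3 phi D := by
  rw [Submodule.mem_span_singleton]
  constructor
  · rintro ⟨a, rfl⟩
    refine ⟨?_, ?_⟩
    · rw [show a • stabDer = der (a • ![1, 2, 0, 0, 0, 0, 0, 0, 0, 0, 0, 0, 0, 0, 0]) from
        (derMap.map_smul a _).symm]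
      exact isDeriv_der _
    · refine (stab3_smul_iff coeff_ne_zero phi₀ _).2 fun x y z => ?_
      have h := stab3_phi₀_stabDer x y z
      simp only [phi₀, w3_apply, LinearMap.smul_apply, Pi.smul_apply, smul_eq_mul,
        AlternatingMap.add_apply, AlternatingMap.sub_apply, AlternatingMap.smul_apply] at h ⊢
      linear_combination a * h
  · rintro ⟨hD, hs⟩
    obtain ⟨p, rfl⟩ := hD.exists_der
    have hs' : Stab3 (phi₀ + (0 : ℝ) • eta) (der p) := by
      rw [zero_smul, add_zero]
      exact (stab3_smul_iff coeff_ne_zero phi₀ _).1 hs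
    obtain ⟨h012, h013, h014, h015, h016, h023, h024, h025, h026, h034, h035, h045, h046, h056,
      h123, h124, h125, h126, h134, h135, h145, h146, h234, h235, h236, h245, h345⟩ :=
      stab3_relations hs'
    refine ⟨p 0, ((derMap.map_smul (p 0) _).symm.trans ?_ : p 0 • stabDer = der p)⟩
    refine congrArg der ?_
    ext i
    fin_cases i <;> simp <;> linarith

lemma eq_zero_of_stab3 {q : ℝ} (hq : q ≠ 0) {D : V →ₗ[ℝ] V} (hD : IsDeriv D)
    (hs : Stab3 (phi₀ + q • eta) D) : D = 0 := by
  obtain ⟨p, rfl⟩ := hD.exists_der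
  obtain ⟨h012, h013, h014, h015, h016, h023, h024, h025, h026, h034, h035, h045, h046, h056, h123,
    h124, h125, h126, h134, h135, h145, h146, h234, h235, h236, h245, h345⟩ :=
    stab3_relations hs
  have p2 : p 2 = 0 := by linarith
  have p1 : p 1 = 2 * p 0 := by linarith
  simp only [p2, p1]
    at h012 h013 h024 h026 h045 h046 h056 h125 h126 h145 h146 h234 h235 h236 h345
  have h : 2 * p 3 - p 4 - 2 * p 11 = 0 :=
    (mul_eq_zero.1 (by linarith : q * (2 * p 3 - p 4 - 2 * p 11) = 0)).resolve_left hq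
  have p0 : p 0 = 0 := (mul_eq_zero.1 (by linarith : q * p 0 = 0)).resolve_left hq
  simp only [p0]
    at h026 h045 h125 h126 h145 h234 h235 h012 h024 p1
  have p3 : p 3 = 0 := by linarith
  have p4 : p 4 = 0 := by linarith
  have p8 : p 8 = 0 := by linarith
  have p11 : p 11 = 0 := by linarith
  have p5 : p 5 = 0 := by linarith
  have p7 : p 7 = 0 := by linarith
  have p12 : p 12 = -(q * p 9) := by linarith
  have p9 : p 9 = 0 := by
    have : (2 + q ^ 2) * p 9 = 0 := by
      rw [p12] at h012
      linarith
    exact (mul_eq_zero.1 this).resolve_left (by positivity)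
  have p6 : p 6 = 0 := by linarith
  have p10 : p 10 = 0 := by linarith
  have p13 : p 13 = 0 := by
    rw [p7] at h015
    linarith
  have p14 : p 14 = 0 := by
    rw [p11] at h024
    linarith
  rw [p9] at p12
  refine (congrArg der ?_ : der p = der 0).trans derMap.map_zero
  ext i
  fin_cases i <;> simp <;> linarith

theorem statement_2 :
    (∃ Z : Submodule ℝ (AlternatingMap ℝ V ℝ (Fin 3)),
      (∀ φ, φ ∈ Z ↔ Closed3 φ) ∧ Module.finrank ℝ Z = 20) ∧
    (∃ W : Submodule ℝ (V →ₗ[ℝ] V),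
      (∀ D, D ∈ W ↔ IsDeriv D) ∧ Module.finrank ℝ W = 15) ∧
    Closed3 phi ∧
    (∃ S : Submodule ℝ (V →ₗ[ℝ] V),
      (∀ D, D ∈ S ↔ IsDeriv D ∧ Stab3 phi D) ∧ Module.finrank ℝ S = 1) ∧
    (∃ δ : ℝ, 0 < δ ∧ ∀ ε : ℝ, 0 < |ε| → |ε| < δ →
      ∀ D : V →ₗ[ℝ] V, IsDeriv D → Stab3 (phi + ε • eta) D → D = 0) := by
  refine ⟨⟨closedForms, fun _ => Iff.rfl, ?_⟩, ⟨LinearMap.range derMap, fun D => ⟨?_, ?_⟩, ?_⟩,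
    closed3_phi, ⟨Submodule.span ℝ {stabDer}, isDeriv_and_stab3_phi_iff, ?_⟩, 1, one_pos, ?_⟩
  · have h : closedForms = Submodule.span ℝ (Set.range closedBasis) :=
      le_antisymm closedForms_le_span
        (Submodule.span_le.2 (Set.range_subset_iff.2 closed3_closedBasis))
    rw [h, finrank_span_eq_card linearIndependent_closedBasis, Fintype.card_fin]
  · rintro ⟨p, rfl⟩
    exact isDeriv_der p
  · intro h
    obtain ⟨p, rfl⟩ := h.exists_der
    exact ⟨p, rfl⟩
  · rw [LinearMap.finrank_range_of_inj derMap_injective, Module.finrank_fin_fun]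
  · exact finrank_span_singleton stabDer_ne_zero
  · intro ε hε _ D hD hs
    rw [phi_add_smul_eta, stab3_smul_iff coeff_ne_zero] at hs
    exact eq_zero_of_stab3 (div_ne_zero (abs_pos.1 hε) coeff_ne_zero) hD hs
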